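/- Let k ≥ 1 be an integer and let f be a bounded continuous function on [0,∞) with f ∈ W²_0(ψ), D̃f ∈ W²_0(ψ), and D̃f bounded and continuous on (0,∞) with limit 0 at x = 0. Then Ṽ_k f − Ṽ_{k+1} f = −(1/(k(k+1)²))·V_k(D̃²f) on [0,∞). -/

import Mathlib

open MeasureTheory Filter Set

/-- Baskakov basis functions `P_{n,k}(x)`, with `P_{n,k} := 0` for `k < 0`. -/
noncomputable def P (n : ℕ) (k : ℤ) (x : ℝ) : ℝ :=
  if k < 0 then 0
  else (Nat.choose (n + k.toNat - 1) k.toNat : ℝ) * x ^ k.toNat * (1 + x) ^ (-(n : ℤ) - k)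

/-- The weight `ψ(x) = x(1+x)`. -/
noncomputable def psi (x : ℝ) : ℝ := x * (1 + x)

/-- The differential operator `D̃ f = ψ f''`. -/
noncomputable def Dt (f : ℝ → ℝ) : ℝ → ℝ := fun x => psi x * deriv (deriv f) x

/-- The functionals `v_{n,k}`. -/
noncomputable def v (n k : ℕ) (f : ℝ → ℝ) : ℝ :=
  if k = 0 then f 0
  else ((n : ℝ) + 1) * ∫ t in Set.Ioi (0 : ℝ), P (n + 2) ((k : ℤ) - 1) t * f t

/-- The Goodman–Sharma–Baskakov operator `V_n`. -/
noncomputable def V (n : ℕ) (f : ℝ → ℝ) (x : ℝ) : ℝ :=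
  ∑' k : ℕ, v n k f * P n (k : ℤ) x

/-- The modified operator `Ṽ_n`. -/
noncomputable def Vt (n : ℕ) (f : ℝ → ℝ) (x : ℝ) : ℝ :=
  ∑' k : ℕ, v n k f * (P n (k : ℤ) x - (1 / (n : ℝ)) * Dt (P n (k : ℤ)) x)

/-- Supremum norm on `[0,∞)`. -/
noncomputable def supNorm (f : ℝ → ℝ) : ℝ := ⨆ x ∈ Set.Ici (0 : ℝ), |f x|

/-- `f` is bounded and continuous on `[0,∞)`. -/
def BddContOn (f : ℝ → ℝ) : Prop :=
  ContinuousOn f (Set.Ici 0) ∧ ∃ M, ∀ x ∈ Set.Ici (0 : ℝ), |f x| ≤ M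

/-- The space `W²(ψ)`: `g, g'` (locally) differentiable on `(0,∞)` and `D̃ g` bounded. -/
def MemW2 (g : ℝ → ℝ) : Prop :=
  DifferentiableOn ℝ g (Set.Ioi 0) ∧ DifferentiableOn ℝ (deriv g) (Set.Ioi 0) ∧
    ∃ M, ∀ x ∈ Set.Ioi (0 : ℝ), |Dt g x| ≤ M

/-- The space `W²₀(ψ)`: members of `W²(ψ)` with `D̃ g(x) → 0` as `x → 0⁺`. -/
def MemW20 (g : ℝ → ℝ) : Prop :=
  MemW2 g ∧ Filter.Tendsto (Dt g) (nhdsWithin 0 (Set.Ioi 0)) (nhds 0)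

/-- The K-functional `K(f,t)`. -/
noncomputable def Kfun (f : ℝ → ℝ) (t : ℝ) : ℝ :=
  sInf {a : ℝ | ∃ g : ℝ → ℝ, MemW20 g ∧ MemW2 (Dt g) ∧
    a = supNorm (fun x => f x - g x) + t * supNorm (Dt (Dt g))}

/-- The function `T_{n,k}(x)`. -/
noncomputable def T (n : ℕ) (k : ℤ) (x : ℝ) : ℝ :=
  (k : ℝ) * ((k : ℝ) - 1) * (1 + x) / x - 2 * (k : ℝ) * ((n : ℝ) + (k : ℝ))
    + ((n : ℝ) + (k : ℝ)) * ((n : ℝ) + (k : ℝ) + 1) * x / (1 + x)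

lemma P_natCast (n k : ℕ) (x : ℝ) :
    P n (k : ℤ) x = (Nat.choose (n + k - 1) k : ℝ) * x ^ k * ((1 + x) ^ (n + k))⁻¹ := by
  have h : (-(n : ℤ) - k) = -((n + k : ℕ) : ℤ) := by push_cast; ring
  rw [P, if_neg (by omega), Int.toNat_natCast, h, zpow_neg, zpow_natCast]

lemma P_of_neg (n : ℕ) {k : ℤ} (hk : k < 0) : P n k = 0 := by
  funext x
  simp [P, hk]

lemma P_nonneg (n : ℕ) (k : ℤ) {x : ℝ} (hx : 0 ≤ x) : 0 ≤ P n k x := by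
  unfold P
  split_ifs
  · exact le_rfl
  · positivity

/-- The binomial recursion in the lower index. -/
lemma succ_mul_choose_basis {n : ℕ} (hn : 1 ≤ n) (k : ℕ) :
    ((k : ℝ) + 1) * (Nat.choose (n + (k + 1) - 1) (k + 1) : ℝ)
      = ((n : ℝ) + k) * (Nat.choose (n + k - 1) k : ℝ) := by
  obtain ⟨m, rfl⟩ : ∃ m, n = m + 1 := ⟨n - 1, by omega⟩
  have h := Nat.add_one_mul_choose_eq (m + k) k
  rw [show m + 1 + (k + 1) - 1 = m + k + 1 by omega, show m + 1 + k - 1 = m + k by omega]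
  have h' : ((m + k + 1 : ℕ) : ℝ) * (Nat.choose (m + k) k : ℝ)
      = (Nat.choose (m + k + 1) (k + 1) : ℝ) * ((k + 1 : ℕ) : ℝ) := by exact_mod_cast h
  push_cast at h' ⊢
  linarith

/-- The binomial recursion in the upper index. -/
lemma mul_choose_basis_succ {n : ℕ} (hn : 1 ≤ n) (k : ℕ) :
    (n : ℝ) * (Nat.choose (n + 1 + k - 1) k : ℝ)
      = ((n : ℝ) + k) * (Nat.choose (n + k - 1) k : ℝ) := by
  obtain ⟨m, rfl⟩ : ∃ m, n = m + 1 := ⟨n - 1, by omega⟩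
  have h := Nat.choose_mul_succ_eq (m + k) k
  rw [show m + k + 1 - k = m + 1 by omega] at h
  rw [show m + 1 + 1 + k - 1 = m + k + 1 by omega, show m + 1 + k - 1 = m + k by omega]
  have h' : (Nat.choose (m + k) k : ℝ) * ((m + k + 1 : ℕ) : ℝ)
      = (Nat.choose (m + k + 1) k : ℝ) * ((m + 1 : ℕ) : ℝ) := by exact_mod_cast h
  push_cast at h' ⊢
  linarith

lemma hasDerivAt_P {n : ℕ} (hn : 1 ≤ n) (k : ℤ) {x : ℝ} (hx : -1 < x) :
    HasDerivAt (P n k) ((n : ℝ) * (P (n + 1) (k - 1) x - P (n + 1) k x)) x := by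
  have h1 : 1 + x ≠ 0 := by linarith
  have hbase (m : ℕ) : HasDerivAt (fun y : ℝ => ((1 + y) ^ m)⁻¹)
      (-(m * (1 + x) ^ (m - 1)) / ((1 + x) ^ m) ^ 2) x := by
    have := (((hasDerivAt_id x).const_add 1).pow m).inv (pow_ne_zero m h1)
    simpa using! this
  rcases lt_or_ge k 0 with hk | hk
  · rw [P_of_neg n hk, P_of_neg (n + 1) hk, P_of_neg (n + 1) (by omega : k - 1 < 0)]
    simp
  · lift k to ℕ using hk
    have hP : P n (k : ℤ) = fun y => (Nat.choose (n + k - 1) k : ℝ) * y ^ k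
        * ((1 + y) ^ (n + k))⁻¹ := by
      funext y
      exact P_natCast n k y
    rw [hP]
    cases k with
    | zero =>
      rw [P_of_neg (n + 1) (by simp : ((0 : ℕ) : ℤ) - 1 < 0), P_natCast]
      have := hbase n
      obtain ⟨m, rfl⟩ : ∃ m, n = m + 1 := ⟨n - 1, by omega⟩
      simp only [Nat.choose_zero_right, Nat.cast_one, pow_zero, one_mul, add_zero]
      convert! this using 1
      simp only [Pi.zero_apply, Nat.add_sub_cancel]
      field_simp
      ring
    | succ k =>
      rw [show (((k + 1 : ℕ) : ℤ) - 1) = (k : ℤ) by push_cast; ring, P_natCast, P_natCast]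
      have e1 := succ_mul_choose_basis hn k
      have e2 := mul_choose_basis_succ hn k
      have e3 := mul_choose_basis_succ hn (k + 1)
      have := ((hasDerivAt_pow (k + 1) x).const_mul
        (Nat.choose (n + (k + 1) - 1) (k + 1) : ℝ)).mul (hbase (n + (k + 1)))
      convert! this using 1
      rw [mul_sub, ← mul_assoc, ← mul_assoc, ← mul_assoc, ← mul_assoc, e2, e3, ← e1]
      simp only [Nat.add_sub_cancel,
        show n + 1 + k = n + k + 1 by omega, show n + (k + 1) = n + k + 1 by omega,
        show n + 1 + (k + 1) = n + k + 2 by omega]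
      push_cast
      field_simp
      ring

/-- The weight relation between `P_{n,k}` and `P_{n+2,k-1}`. -/
lemma weight_mul_P {n : ℕ} (hn : 1 ≤ n) (k : ℤ) {x : ℝ} (hx : -1 < x) :
    (n : ℝ) * (n + 1) * psi x * P (n + 2) (k - 1) x = (k : ℝ) * (n + k) * P n k x := by
  have h1 : 1 + x ≠ 0 := by linarith
  rcases lt_trichotomy k 0 with hk | rfl | hk
  · rw [P_of_neg n hk, P_of_neg (n + 2) (by omega : k - 1 < 0)]
    simp
  · rw [P_of_neg (n + 2) (by omega : (0 : ℤ) - 1 < 0)]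
    simp
  · obtain ⟨m, rfl⟩ : ∃ m : ℕ, k = ((m + 1 : ℕ) : ℤ) := ⟨(k - 1).toNat, by omega⟩
    rw [show (((m + 1 : ℕ) : ℤ) - 1) = (m : ℤ) by push_cast; ring, P_natCast, P_natCast]
    have e1 := succ_mul_choose_basis hn m
    have e2 := mul_choose_basis_succ hn m
    have e3 := mul_choose_basis_succ (n := n + 1) (by omega) m
    simp only [show n + 1 + 1 + m - 1 = n + 2 + m - 1 by omega] at e3
    have e4 : (n : ℝ) * (n + 1) * (Nat.choose (n + 2 + m - 1) m : ℝ)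
        = (m + 1) * (n + (m + 1)) * (Nat.choose (n + (m + 1) - 1) (m + 1) : ℝ) := by
      push_cast at e3
      linear_combination (n : ℝ) * e3 + ((n : ℝ) + 1 + m) * e2 - ((n : ℝ) + 1 + m) * e1
    rw [show (n : ℝ) * (n + 1) * psi x * ((Nat.choose (n + 2 + m - 1) m : ℝ) * x ^ m
        * ((1 + x) ^ (n + 2 + m))⁻¹) = ((n : ℝ) * (n + 1) * (Nat.choose (n + 2 + m - 1) m : ℝ))
        * (psi x * x ^ m * ((1 + x) ^ (n + 2 + m))⁻¹) by ring, e4]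
    simp only [psi, show n + 2 + m = n + m + 2 by omega, show n + (m + 1) = n + m + 1 by omega]
    push_cast
    field_simp
    ring

/-- Expressing the basis of order `n + 1` through the basis of order `n`. -/
lemma mul_P_succ {n : ℕ} (hn : 1 ≤ n) (k : ℤ) {x : ℝ} (hx : -1 < x) :
    (n : ℝ) * P (n + 1) k x = ((n : ℝ) + k) * P n k x - ((k : ℝ) + 1) * P n (k + 1) x := by
  have h1 : 1 + x ≠ 0 := by linarith
  rcases lt_trichotomy k (-1) with hk | rfl | hk
  · rw [P_of_neg n (by omega : k < 0), P_of_neg n (by omega : k + 1 < 0),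
      P_of_neg (n + 1) (by omega : k < 0)]
    simp
  · rw [P_of_neg n (by omega : (-1 : ℤ) < 0), P_of_neg (n + 1) (by omega : (-1 : ℤ) < 0)]
    simp
  · lift k to ℕ using by omega
    rw [show ((k : ℤ) + 1) = ((k + 1 : ℕ) : ℤ) by push_cast; ring, P_natCast, P_natCast,
      P_natCast, ← mul_assoc, ← mul_assoc, ← mul_assoc, ← mul_assoc, ← mul_assoc, ← mul_assoc,
      mul_choose_basis_succ hn k]
    rw [show ((k : ℤ) : ℝ) = (k : ℝ) by simp, succ_mul_choose_basis hn k]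
    simp only [show n + 1 + k = n + k + 1 by omega, show n + (k + 1) = n + k + 1 by omega]
    field_simp
    ring

lemma Dt_P {n : ℕ} (hn : 1 ≤ n) (k : ℤ) {x : ℝ} (hx : -1 < x) :
    Dt (P n k) x = ((k : ℝ) - 1) * (n + (k - 1)) * P n (k - 1) x - 2 * (k * (n + k) * P n k x)
      + ((k : ℝ) + 1) * (n + (k + 1)) * P n (k + 1) x := by
  have hev : deriv (P n k) =ᶠ[nhds x]
      fun y => (n : ℝ) * (P (n + 1) (k - 1) y - P (n + 1) k y) := by
    filter_upwards [Ioi_mem_nhds hx] with y hy using (hasDerivAt_P hn k hy).deriv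
  have hd : HasDerivAt (fun y => (n : ℝ) * (P (n + 1) (k - 1) y - P (n + 1) k y)) _ x :=
    (((hasDerivAt_P (n := n + 1) (by omega) (k - 1) hx).sub
      (hasDerivAt_P (n := n + 1) (by omega) k hx)).const_mul (n : ℝ))
  rw [Dt, hev.deriv_eq, hd.deriv]
  have w0 := weight_mul_P hn (k - 1) hx
  have w1 := weight_mul_P hn k hx
  have w2 := weight_mul_P hn (k + 1) hx
  rw [add_sub_cancel_right] at w2
  push_cast at w0 w1 w2 ⊢
  linear_combination w0 - 2 * w1 + w2

lemma P_natCast_zero (n k : ℕ) : P n (k : ℤ) 0 = if k = 0 then 1 else 0 := by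
  rw [P_natCast]
  split_ifs with h
  · simp [h]
  · simp [h]

lemma exists_P_le (n : ℕ) (k : ℤ) :
    ∃ C, 0 ≤ C ∧ ∀ x, 0 ≤ x → P n k x ≤ C * ((1 + x) ^ n)⁻¹ := by
  rcases lt_or_ge k 0 with hk | hk
  · exact ⟨0, le_rfl, fun x _ => by simp [P_of_neg n hk]⟩
  · lift k to ℕ using hk
    refine ⟨Nat.choose (n + k - 1) k, by positivity, fun x hx => ?_⟩
    have hk : x ^ k * ((1 + x) ^ k)⁻¹ ≤ 1 := by
      rw [← div_eq_mul_inv]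
      exact div_le_one_of_le₀ (pow_le_pow_left₀ hx (by linarith) k) (by positivity)
    calc P n (k : ℤ) x = ((Nat.choose (n + k - 1) k : ℝ) * ((1 + x) ^ n)⁻¹)
          * (x ^ k * ((1 + x) ^ k)⁻¹) := by
          rw [P_natCast, pow_add, mul_inv]
          ring
      _ ≤ _ := mul_le_of_le_one_right (by positivity) hk

lemma tendsto_P_atTop {n : ℕ} (hn : 1 ≤ n) (k : ℤ) : Tendsto (P n k) atTop (nhds 0) := by
  obtain ⟨C, -, hC⟩ := exists_P_le n k
  have h : Tendsto (fun x : ℝ => C * ((1 + x) ^ n)⁻¹) atTop (nhds (C * 0)) :=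
    (((tendsto_pow_atTop (by omega)).comp
      (tendsto_atTop_add_const_left atTop (1 : ℝ) tendsto_id)).inv_tendsto_atTop).const_mul C
  rw [mul_zero] at h
  refine tendsto_of_tendsto_of_tendsto_of_le_of_le' tendsto_const_nhds h ?_ ?_
  · filter_upwards [eventually_ge_atTop 0] with x hx using P_nonneg n k hx
  · filter_upwards [eventually_ge_atTop 0] with x hx using hC x hx

lemma integrableOn_P (n : ℕ) (k : ℤ) : IntegrableOn (P (n + 2) k) (Ioi 0) := by
  obtain ⟨C, hC0, hC⟩ := exists_P_le (n + 2) k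
  have hint : IntegrableOn (fun x : ℝ => C * (x + 1) ^ (-2 : ℝ)) (Ioi 0) :=
    (integrableOn_add_rpow_Ioi_of_lt (by norm_num) (by norm_num)).const_mul C
  refine Integrable.mono' hint ?_ ?_
  · refine ContinuousOn.aestronglyMeasurable (fun x hx => ?_) measurableSet_Ioi
    have hx' : (0 : ℝ) < x := hx
    exact (hasDerivAt_P (by omega) k (by linarith)).continuousAt.continuousWithinAt
  · refine (ae_restrict_iff' measurableSet_Ioi).2 (Eventually.of_forall fun x hx => ?_)
    have hx' : (0 : ℝ) < x := hx
    rw [Real.norm_of_nonneg (P_nonneg _ _ hx'.le)]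
    refine (hC x hx'.le).trans (mul_le_mul_of_nonneg_left ?_ hC0)
    rw [Real.rpow_neg (by linarith), add_comm x 1, show (2 : ℝ) = ((2 : ℕ) : ℝ) by norm_num,
      Real.rpow_natCast]
    exact inv_anti₀ (by positivity) (pow_le_pow_right₀ (by linarith) (by omega))

lemma integrableOn_P_mul (n : ℕ) (k : ℤ) {h : ℝ → ℝ} {B : ℝ}
    (hm : AEStronglyMeasurable h (volume.restrict (Ioi 0)))
    (hB : ∀ x ∈ Ioi (0 : ℝ), |h x| ≤ B) :
    IntegrableOn (fun t => P (n + 2) k t * h t) (Ioi 0) := by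
  refine Integrable.mul_bdd (c := B) (integrableOn_P n k) hm ?_
  exact (ae_restrict_iff' measurableSet_Ioi).2 (Eventually.of_forall hB)

lemma integral_P (n k : ℕ) : ∫ t in Ioi (0 : ℝ), P (n + 2) (k : ℤ) t = ((n : ℝ) + 1)⁻¹ := by
  have key (j : ℤ) : ((n : ℝ) + 1) * ((∫ t in Ioi (0 : ℝ), P (n + 2) (j - 1) t)
      - ∫ t in Ioi (0 : ℝ), P (n + 2) j t) = - P (n + 1) j 0 := by
    rw [← integral_sub (integrableOn_P n _) (integrableOn_P n _), ← integral_const_mul,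
      integral_Ioi_of_hasDerivAt_of_tendsto' (f := P (n + 1) j) (m := 0), zero_sub]
    · intro x hx
      have hx' : (0 : ℝ) ≤ x := hx
      have := hasDerivAt_P (n := n + 1) (by omega) j (by linarith : -1 < x)
      push_cast at this
      exact this
    · exact ((integrableOn_P n _).sub (integrableOn_P n _)).const_mul _
    · exact tendsto_P_atTop (by omega) j
  have hn : (n : ℝ) + 1 ≠ 0 := by positivity
  induction k with
  | zero =>
    have := key ((0 : ℕ) : ℤ)
    rw [P_natCast_zero, P_of_neg (n + 2) (by simp : ((0 : ℕ) : ℤ) - 1 < 0)] at this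
    simp only [Pi.zero_apply, integral_zero, if_true] at this
    field_simp
    linarith
  | succ k ih =>
    have := key ((k + 1 : ℕ) : ℤ)
    rw [P_natCast_zero, show (((k + 1 : ℕ) : ℤ) - 1) = (k : ℤ) by push_cast; ring, ih] at this
    simp only [Nat.add_eq_zero_iff, one_ne_zero, and_false, if_false, neg_zero, mul_eq_zero, hn,
      false_or] at this
    linarith

lemma v_eq (n k : ℕ) (h : ℝ → ℝ) :
    v n k h = ((n : ℝ) + 1) * (∫ t in Ioi (0 : ℝ), P (n + 2) ((k : ℤ) - 1) t * h t)
      + if k = 0 then h 0 else 0 := by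
  unfold v
  split_ifs with hk
  · rw [P_of_neg (n + 2) (by omega : (k : ℤ) - 1 < 0)]
    simp
  · simp

lemma v_succ (n k : ℕ) (h : ℝ → ℝ) :
    v n (k + 1) h = ((n : ℝ) + 1) * ∫ t in Ioi (0 : ℝ), P (n + 2) (k : ℤ) t * h t := by
  rw [v_eq, if_neg (by omega), show (((k + 1 : ℕ) : ℤ) - 1) = (k : ℤ) by push_cast; ring, add_zero]

lemma abs_v_le (n k : ℕ) {h : ℝ → ℝ} {B : ℝ} (hB : ∀ x ∈ Ici (0 : ℝ), |h x| ≤ B) :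
    |v n k h| ≤ B := by
  cases k with
  | zero => simpa [v] using hB 0 (by simp)
  | succ k =>
    rw [v_succ, abs_mul, abs_of_nonneg (by positivity)]
    have hle : |∫ t in Ioi (0 : ℝ), P (n + 2) (k : ℤ) t * h t|
        ≤ ∫ t in Ioi (0 : ℝ), P (n + 2) (k : ℤ) t * B := by
      refine norm_integral_le_of_norm_le (f := fun t => P (n + 2) (k : ℤ) t * h t)
        ((integrableOn_P n k).mul_const B) ?_
      refine (ae_restrict_iff' measurableSet_Ioi).2 (Eventually.of_forall fun x hx => ?_)
      have hx' : (0 : ℝ) < x := hx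
      rw [norm_mul, Real.norm_of_nonneg (P_nonneg _ _ hx'.le)]
      exact mul_le_mul_of_nonneg_left (hB x hx'.le) (P_nonneg _ _ hx'.le)
    rw [integral_mul_const, integral_P] at hle
    calc ((n : ℝ) + 1) * |∫ t in Ioi (0 : ℝ), P (n + 2) (k : ℤ) t * h t|
        ≤ ((n : ℝ) + 1) * (((n : ℝ) + 1)⁻¹ * B) := by gcongr
      _ = B := by field_simp

lemma aestronglyMeasurable_Ioi {h : ℝ → ℝ} (hc : ContinuousOn h (Ici 0)) :
    AEStronglyMeasurable h (volume.restrict (Ioi 0)) :=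
  (hc.mono Ioi_subset_Ici_self).aestronglyMeasurable measurableSet_Ioi

/-- The functionals of order `n + 1` in terms of those of order `n`. -/
lemma mul_v_succ (n k : ℕ) {h : ℝ → ℝ} (hh : BddContOn h) :
    ((n : ℝ) + 1) * v (n + 1) k h
      = ((n : ℝ) + k + 1) * v n k h - (k : ℝ) * v n (k + 1) h := by
  obtain ⟨hc, B, hB⟩ := hh
  have hi (j : ℤ) := integrableOn_P_mul n j (aestronglyMeasurable_Ioi hc)
    (fun x hx => hB x (Ioi_subset_Ici_self hx))
  cases k with
  | zero => simp [v]
  | succ k =>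
    have hint : ((n : ℝ) + 2) * (∫ t in Ioi (0 : ℝ), P (n + 1 + 2) (k : ℤ) t * h t)
        = ((n : ℝ) + 2 + k) * (∫ t in Ioi (0 : ℝ), P (n + 2) (k : ℤ) t * h t)
          - ((k : ℝ) + 1) * ∫ t in Ioi (0 : ℝ), P (n + 2) (k + 1 : ℤ) t * h t := by
      rw [← integral_const_mul, ← integral_const_mul, ← integral_const_mul,
        ← integral_sub ((hi _).const_mul _) ((hi _).const_mul _)]
      refine setIntegral_congr_fun measurableSet_Ioi fun t ht => ?_
      have ht' : (0 : ℝ) < t := ht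
      have := mul_P_succ (n := n + 2) (by omega) (k : ℤ) (by linarith : -1 < t)
      push_cast at this
      rw [show n + 1 + 2 = n + 2 + 1 by omega]
      linear_combination h t * this
    rw [v_succ, v_succ, v_succ]
    push_cast
    linear_combination ((n : ℝ) + 1) * hint

/-- A pointwise bound for the first derivative through the values and the weighted second
derivative. -/
lemma abs_mul_deriv_le {h : ℝ → ℝ} {M : ℝ} (hd : DifferentiableOn ℝ h (Ioi 0))
    (hd' : DifferentiableOn ℝ (deriv h) (Ioi 0)) (hM : ∀ x ∈ Ioi (0 : ℝ), |Dt h x| ≤ M)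
    {t : ℝ} (ht : 0 < t) :
    |t * deriv h t| ≤ |h (2 * t) - h t| + M * (t / (1 + t)) := by
  have hlt : t < 2 * t := by linarith
  have hsub {a b : ℝ} (ha : t ≤ a) : Icc a b ⊆ Ioi 0 := fun y hy => ht.trans_le (ha.trans hy.1)
  obtain ⟨ξ, ⟨hξ1, hξ2⟩, hξ⟩ := exists_deriv_eq_slope h hlt (hd.continuousOn.mono (hsub le_rfl))
    (hd.mono (Ioo_subset_Icc_self.trans (hsub le_rfl)))
  obtain ⟨c, ⟨hc1, hc2⟩, hc⟩ := exists_deriv_eq_slope (deriv h) hξ1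
    (hd'.continuousOn.mono (hsub le_rfl)) (hd'.mono (Ioo_subset_Icc_self.trans (hsub le_rfl)))
  have hM0 : 0 ≤ M := (abs_nonneg _).trans (hM t ht)
  have hc0 : 0 < c := ht.trans hc1
  have hDt := hM c hc0
  have hpsi : t * (1 + t) ≤ psi c := by
    unfold psi
    gcongr
  rw [Dt, abs_mul, abs_of_nonneg ((by positivity : 0 ≤ t * (1 + t)).trans hpsi)] at hDt
  have hc'' : t * (1 + t) * |deriv (deriv h) c| ≤ M :=
    (mul_le_mul_of_nonneg_right hpsi (abs_nonneg _)).trans hDt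
  have hslope : t * deriv h ξ = h (2 * t) - h t := by
    rw [hξ]
    have : 2 * t - t ≠ 0 := by linarith
    field_simp
    ring
  have hdiff : deriv h ξ - deriv h t = deriv (deriv h) c * (ξ - t) := by
    rw [hc]
    have : ξ - t ≠ 0 := by linarith
    field_simp
  have heq : t * deriv h t = (h (2 * t) - h t) - t * (ξ - t) * deriv (deriv h) c := by
    linear_combination hslope - t * hdiff
  have hsecond : |t * (ξ - t) * deriv (deriv h) c| ≤ M * (t / (1 + t)) := by
    rw [abs_mul, abs_of_nonneg (mul_nonneg ht.le (by linarith)), ← mul_div_assoc,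
      le_div_iff₀ (by linarith)]
    calc t * (ξ - t) * |deriv (deriv h) c| * (1 + t)
        = (t * (1 + t) * |deriv (deriv h) c|) * (ξ - t) := by ring
      _ ≤ M * t := mul_le_mul hc'' (by linarith) (by linarith) hM0
  rw [heq]
  exact (abs_sub _ _).trans (by linarith)

lemma tendsto_mul_deriv_zero {h : ℝ → ℝ} (hh : BddContOn h) (hW : MemW2 h) :
    Tendsto (fun t => t * deriv h t) (nhdsWithin 0 (Ioi 0)) (nhds 0) := by
  obtain ⟨hd, hd', M, hM⟩ := hW
  have h1 : Tendsto h (nhdsWithin 0 (Ioi 0)) (nhds (h 0)) :=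
    (hh.1 0 self_mem_Ici).mono_left (nhdsWithin_mono _ Ioi_subset_Ici_self)
  have hdbl : Tendsto (fun t : ℝ => 2 * t) (nhdsWithin 0 (Ioi 0)) (nhdsWithin 0 (Ioi 0)) := by
    refine tendsto_nhdsWithin_iff.2 ⟨?_, ?_⟩
    · have : Tendsto (fun t : ℝ => 2 * t) (nhds 0) (nhds (2 * 0)) :=
        (continuous_const.mul continuous_id).tendsto 0
      rw [mul_zero] at this
      exact this.mono_left nhdsWithin_le_nhds
    · filter_upwards [self_mem_nhdsWithin] with t ht
      have ht' : (0 : ℝ) < t := ht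
      exact mul_pos two_pos ht'
  have h2 : Tendsto (fun t : ℝ => M * (t / (1 + t))) (nhdsWithin 0 (Ioi 0)) (nhds 0) := by
    have hc : ContinuousAt (fun t : ℝ => M * (t / (1 + t))) 0 := by
      refine ContinuousAt.mul continuousAt_const (continuousAt_id.div ?_ (by simp))
      fun_prop
    have := hc.tendsto
    simp only [zero_div, mul_zero] at this
    exact this.mono_left nhdsWithin_le_nhds
  have h3 := ((h1.comp hdbl).sub h1).abs.add h2
  rw [sub_self, abs_zero, add_zero] at h3
  refine squeeze_zero_norm' ?_ h3
  filter_upwards [self_mem_nhdsWithin] with t ht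
  exact abs_mul_deriv_le hd hd' hM ht

lemma tendsto_deriv_atTop {h : ℝ → ℝ} (hh : BddContOn h) (hW : MemW2 h) :
    Tendsto (deriv h) atTop (nhds 0) := by
  obtain ⟨hd, hd', M, hM⟩ := hW
  obtain ⟨-, B, hB⟩ := hh
  have hlim : Tendsto (fun t : ℝ => (2 * B + M) / t) atTop (nhds 0) :=
    tendsto_const_nhds.div_atTop tendsto_id
  refine squeeze_zero_norm' ?_ hlim
  filter_upwards [eventually_gt_atTop 0] with t ht
  have hM0 : 0 ≤ M := (abs_nonneg _).trans (hM t ht)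
  have h1 := abs_mul_deriv_le hd hd' hM ht
  have h2 : M * (t / (1 + t)) ≤ M :=
    mul_le_of_le_one_right hM0 (div_le_one_of_le₀ (by linarith) (by linarith))
  have h3 := abs_sub (h (2 * t)) (h t)
  have h4 := hB (2 * t) (mem_Ici.2 (by linarith))
  have h5 := hB t (mem_Ici.2 ht.le)
  rw [abs_mul, abs_of_pos ht] at h1
  rw [Real.norm_eq_abs, le_div_iff₀ ht]
  linarith

/-- Improper integral of a derivative on `(0,∞)` with prescribed limits at both ends. -/
lemma integral_Ioi_of_hasDerivAt_of_tendsto_both {F F' : ℝ → ℝ} {a L m : ℝ}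
    (hderiv : ∀ x ∈ Ioi a, HasDerivAt F (F' x) x) (hint : IntegrableOn F' (Ioi a))
    (hL : Tendsto F (nhdsWithin a (Ioi a)) (nhds L)) (hm : Tendsto F atTop (nhds m)) :
    ∫ x in Ioi a, F' x = m - L := by
  have hev : ∀ x ∈ Ioi a, Function.update F a L =ᶠ[nhds x] F := fun x hx => by
    filter_upwards [Ioi_mem_nhds hx] with y hy
    exact Function.update_of_ne (ne_of_gt hy) _ _
  have := integral_Ioi_of_hasDerivAt_of_tendsto (f := Function.update F a L) (a := a) (m := m)
    (f' := F') ?_ (fun x hx => (hderiv x hx).congr_of_eventuallyEq (hev x hx)) hint ?_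
  · rwa [Function.update_self] at this
  · rw [continuousWithinAt_update_same]
    simpa using hL
  · refine hm.congr' ?_
    filter_upwards [eventually_gt_atTop a] with y hy
    exact (Function.update_of_ne (ne_of_gt hy) _ _).symm

/-- The functionals applied to `D̃ h` are weighted second differences. -/
lemma v_succ_Dt {n : ℕ} (hn : 1 ≤ n) (k : ℕ) {h : ℝ → ℝ} (hh : BddContOn h) (hW : MemW2 h) :
    v n (k + 1) (Dt h) = ((k : ℝ) + 1) * (n + (k + 1))
      * (v n k h - 2 * v n (k + 1) h + v n (k + 2) h) := by
  have hh' := hh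
  have hW' := hW
  obtain ⟨hc, B, hB⟩ := hh
  obtain ⟨hd, hd', M, hM⟩ := hW
  have hi (j : ℤ) := integrableOn_P_mul n j (aestronglyMeasurable_Ioi hc)
    (fun x hx => hB x (Ioi_subset_Ici_self hx))
  have hmeas : AEStronglyMeasurable (Dt h) (volume.restrict (Ioi 0)) := by
    have : Measurable (Dt h) := by
      unfold Dt psi
      exact (measurable_id.mul (measurable_const.add measurable_id)).mul (measurable_deriv _)
    exact this.aestronglyMeasurable
  have hiD := integrableOn_P_mul n (k : ℤ) hmeas hM
  set c : ℝ := ((k : ℝ) + 1) * (n + (k + 1)) with hc_def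
  set P' : ℝ → ℝ := fun t => (n : ℝ) * (P (n + 1) (k : ℤ) t - P (n + 1) (k + 1 : ℤ) t) with hP'_def
  set P'' : ℝ → ℝ := fun t => (n : ℝ) * (n + 1) * (P (n + 2) ((k : ℤ) - 1) t
    - 2 * P (n + 2) (k : ℤ) t + P (n + 2) (k + 1 : ℤ) t) with hP''_def
  have hP' {x : ℝ} (hx : -1 < x) : HasDerivAt (P n (k + 1 : ℤ)) (P' x) x := by
    have := hasDerivAt_P hn (k + 1 : ℤ) hx
    rwa [add_sub_cancel_right] at this
  have hP'' {x : ℝ} (hx : -1 < x) : HasDerivAt P' (P'' x) x := by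
    have := ((hasDerivAt_P (n := n + 1) (by omega) (k : ℤ) hx).sub
      (hasDerivAt_P (n := n + 1) (by omega) (k + 1 : ℤ) hx)).const_mul (n : ℝ)
    convert! this using 1
    rw [add_sub_cancel_right, hP''_def]
    push_cast
    ring
  have hderiv : ∀ x ∈ Ioi (0 : ℝ), HasDerivAt
      (fun t => c * (P n (k + 1 : ℤ) t * deriv h t - P' t * h t))
      ((n : ℝ) * (n + 1) * (P (n + 2) (k : ℤ) x * Dt h x) - c * (P'' x * h x)) x := by
    intro x hx
    have hx' : (0 : ℝ) < x := hx
    have hx1 : -1 < x := by linarith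
    have d0 := (hd.differentiableAt (Ioi_mem_nhds hx')).hasDerivAt
    have d1 := (hd'.differentiableAt (Ioi_mem_nhds hx')).hasDerivAt
    convert! (((hP' hx1).mul d1).sub ((hP'' hx1).mul d0)).const_mul c using 1
    have hw := weight_mul_P hn (k + 1 : ℤ) hx1
    rw [add_sub_cancel_right] at hw
    push_cast at hw
    rw [Dt]
    linear_combination deriv (deriv h) x * hw
  have hiP'' : IntegrableOn (fun t => P'' t * h t) (Ioi 0) := by
    have := ((((hi ((k : ℤ) - 1)).sub ((hi (k : ℤ)).const_mul 2)).add (hi (k + 1 : ℤ))).const_mul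
      ((n : ℝ) * (n + 1)))
    refine this.congr (Eventually.of_forall fun t => ?_)
    simp only [hP''_def, Pi.add_apply, Pi.sub_apply]
    ring
  have hzero : Tendsto (fun t => c * (P n (k + 1 : ℤ) t * deriv h t - P' t * h t))
      (nhdsWithin 0 (Ioi 0)) (nhds (c * (P' 0 * 0 - P' 0 * h 0))) := by
    have hP0 : P n (k + 1 : ℤ) 0 = 0 := by
      have := P_natCast_zero n (k + 1)
      push_cast at this
      simpa using this
    have hslope : Tendsto (fun t => t⁻¹ * P n (k + 1 : ℤ) t) (nhdsWithin 0 (Ioi 0))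
        (nhds (P' 0)) := by
      have := (hP' (by norm_num : (-1 : ℝ) < 0)).tendsto_slope_zero_right
      simpa [hP0] using this
    have h1 : Tendsto (fun t => P n (k + 1 : ℤ) t * deriv h t) (nhdsWithin 0 (Ioi 0))
        (nhds (P' 0 * 0)) := by
      refine (hslope.mul (tendsto_mul_deriv_zero hh' hW')).congr' ?_
      filter_upwards [self_mem_nhdsWithin] with t ht
      have ht' : t ≠ 0 := ne_of_gt ht
      field_simp
    have h2 : Tendsto h (nhdsWithin 0 (Ioi 0)) (nhds (h 0)) :=
      (hc 0 self_mem_Ici).mono_left (nhdsWithin_mono _ Ioi_subset_Ici_self)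
    have h3 : Tendsto P' (nhdsWithin 0 (Ioi 0)) (nhds (P' 0)) :=
      (hP'' (by norm_num : (-1 : ℝ) < 0)).continuousAt.tendsto.mono_left nhdsWithin_le_nhds
    exact (h1.sub (h3.mul h2)).const_mul c
  have hinf : Tendsto (fun t => c * (P n (k + 1 : ℤ) t * deriv h t - P' t * h t))
      atTop (nhds 0) := by
    have h1 := (tendsto_P_atTop hn (k + 1 : ℤ)).mul (tendsto_deriv_atTop hh' hW')
    have h2 : Tendsto P' atTop (nhds 0) := by
      have := ((tendsto_P_atTop (n := n + 1) (by omega) (k : ℤ)).sub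
        (tendsto_P_atTop (n := n + 1) (by omega) (k + 1 : ℤ))).const_mul (n : ℝ)
      simpa using this
    have h3 : Tendsto (fun t => P' t * h t) atTop (nhds 0) := by
      refine h2.zero_mul_isBoundedUnder_le ?_
      refine isBoundedUnder_of_eventually_le (a := B) ?_
      filter_upwards [eventually_ge_atTop 0] with t ht using hB t ht
    simpa using (h1.sub h3).const_mul c
  have hFTC := integral_Ioi_of_hasDerivAt_of_tendsto_both hderiv
    ((hiD.const_mul _).sub (hiP''.const_mul _)) hzero hinf
  have hsplit : ∫ t in Ioi (0 : ℝ), P'' t * h t = (n : ℝ) * (n + 1)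
      * ((∫ t in Ioi (0 : ℝ), P (n + 2) ((k : ℤ) - 1) t * h t)
        - 2 * (∫ t in Ioi (0 : ℝ), P (n + 2) (k : ℤ) t * h t)
        + ∫ t in Ioi (0 : ℝ), P (n + 2) (k + 1 : ℤ) t * h t) := by
    have hs : IntegrableOn (fun t => P (n + 2) ((k : ℤ) - 1) t * h t
        - 2 * (P (n + 2) (k : ℤ) t * h t)) (Ioi 0) := (hi _).sub ((hi _).const_mul _)
    rw [← integral_const_mul, ← integral_sub (hi _) ((hi _).const_mul _),
      ← integral_add hs (hi _), ← integral_const_mul]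
    refine integral_congr_ae (Eventually.of_forall fun t => ?_)
    simp only [hP''_def]
    ring
  have hP'0 : P' 0 = n * if k = 0 then 1 else 0 := by
    have := P_natCast_zero (n + 1) (k + 1)
    push_cast at this
    simp only [hP'_def, P_natCast_zero, this]
    simp
  rw [integral_sub (hiD.const_mul _) (hiP''.const_mul _), integral_const_mul, integral_const_mul,
    hsplit, hP'0] at hFTC
  have hn0 : (n : ℝ) ≠ 0 := by positivity
  rw [v_succ, v_succ, v_succ, v_eq]
  apply mul_left_cancel₀ hn0
  push_cast
  have hite : (if k = 0 then h 0 else 0) = (if k = 0 then (1 : ℝ) else 0) * h 0 := by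
    split_ifs <;> simp
  rw [hite]
  linear_combination hFTC

lemma summable_P {n : ℕ} (hn : 1 ≤ n) {x : ℝ} (hx : 0 ≤ x) :
    Summable (fun k : ℕ => P n (k : ℤ) x) := by
  obtain ⟨m, rfl⟩ : ∃ m, n = m + 1 := ⟨n - 1, by omega⟩
  have hr : ‖x / (1 + x)‖ < 1 := by
    rw [Real.norm_of_nonneg (by positivity), div_lt_one (by linarith)]
    linarith
  refine ((summable_choose_mul_geometric_of_norm_lt_one m hr).mul_right
    ((1 + x) ^ (m + 1))⁻¹).congr fun k => ?_
  rw [P_natCast, show m + 1 + k - 1 = k + m by omega, ← Nat.choose_symm_add, div_pow,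
    pow_add (1 + x) (m + 1) k, mul_inv]
  ring

/-- Summability of the terms occurring in the three-term expansion of `D̃ P_{n,k}`. -/
lemma summable_weight_P {n : ℕ} (hn : 1 ≤ n) {x : ℝ} (hx : 0 ≤ x) :
    Summable (fun k : ℕ => (k : ℝ) * (n + k) * P n (k : ℤ) x) := by
  rw [← summable_nat_add_iff 1]
  refine ((summable_P (n := n + 2) (by omega) hx).mul_left
    ((n : ℝ) * (n + 1) * psi x)).congr fun k => ?_
  have := weight_mul_P hn ((k + 1 : ℕ) : ℤ) (by linarith : -1 < x)
  rw [show (((k + 1 : ℕ) : ℤ) - 1) = (k : ℤ) by push_cast; ring] at this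
  simpa using this

lemma summable_natCast_mul_P {n : ℕ} (hn : 1 ≤ n) {x : ℝ} (hx : 0 ≤ x) :
    Summable (fun k : ℕ => (k : ℝ) * P n (k : ℤ) x) := by
  refine (summable_weight_P hn hx).of_nonneg_of_le
    (fun k => mul_nonneg (by positivity) (P_nonneg _ _ hx)) fun k => ?_
  refine mul_le_mul_of_nonneg_right (le_mul_of_one_le_right (by positivity) ?_) (P_nonneg _ _ hx)
  have : (1 : ℝ) ≤ n := by exact_mod_cast hn
  linarith [(Nat.cast_nonneg k : (0 : ℝ) ≤ k)]

lemma summable_bdd_mul {u w : ℕ → ℝ} {B : ℝ} (hu : ∀ k, |u k| ≤ B) (hw : Summable w)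
    (hw0 : ∀ k, 0 ≤ w k) : Summable (fun k => u k * w k) := by
  refine Summable.of_norm_bounded (hw.mul_left B) fun k => ?_
  rw [norm_mul, Real.norm_of_nonneg (hw0 k)]
  exact mul_le_mul_of_nonneg_right (hu k) (hw0 k)

lemma hasSum_of_hasSum_succ {f : ℕ → ℝ} {a : ℝ} (h0 : f 0 = 0)
    (h : HasSum (fun k => f (k + 1)) a) : HasSum f a := by
  have := (hasSum_nat_add_iff 1).1 h
  simpa [h0] using this

lemma Dt_apply_zero (h : ℝ → ℝ) : Dt h 0 = 0 := by
  simp [Dt, psi]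

lemma hasSum_V {n : ℕ} (hn : 1 ≤ n) {h : ℝ → ℝ} (hh : BddContOn h) {x : ℝ} (hx : 0 ≤ x) :
    HasSum (fun k : ℕ => v n k h * P n (k : ℤ) x) (V n h x) := by
  obtain ⟨-, B, hB⟩ := hh
  exact (summable_bdd_mul (fun k => abs_v_le n k hB) (summable_P hn hx)
    fun k => P_nonneg _ _ hx).hasSum

/-- Summation by parts: applying `D̃` to the basis amounts to applying it to the function. -/
lemma hasSum_v_mul_Dt_P {n : ℕ} (hn : 1 ≤ n) {h : ℝ → ℝ} (hh : BddContOn h) (hW : MemW2 h)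
    {x : ℝ} (hx : 0 ≤ x) :
    HasSum (fun k : ℕ => v n k h * Dt (P n (k : ℤ)) x) (V n (Dt h) x) ∧
      HasSum (fun k : ℕ => v n k (Dt h) * P n (k : ℤ) x) (V n (Dt h) x) := by
  have hh' := hh
  obtain ⟨-, B, hB⟩ := hh
  have hx1 : -1 < x := by linarith
  set W : ℕ → ℝ := fun k => (k : ℝ) * (n + k) * P n (k : ℤ) x with hW_def
  have hW0 : W 0 = 0 := by simp [hW_def]
  have hWs : Summable (fun k => W (k + 1)) := (summable_nat_add_iff 1).2 (summable_weight_P hn hx)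
  have hWnn (k : ℕ) : 0 ≤ W (k + 1) := mul_nonneg (by positivity) (P_nonneg _ _ hx)
  have hs (j : ℕ) : HasSum (fun k => v n (k + j) h * W (k + 1))
      (∑' k, v n (k + j) h * W (k + 1)) :=
    (summable_bdd_mul (fun k => abs_v_le n (k + j) hB) hWs hWnn).hasSum
  have hsum := ((hs 0).sub ((hs 1).mul_left 2)).add (hs 2)
  set S := ∑' k, v n (k + 0) h * W (k + 1) - 2 * ∑' k, v n (k + 1) h * W (k + 1)
    + ∑' k, v n (k + 2) h * W (k + 1) with hS
  have hright : HasSum (fun k : ℕ => v n k (Dt h) * P n (k : ℤ) x) S := by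
    refine hasSum_of_hasSum_succ (by simp [v, Dt_apply_zero]) (hsum.congr_fun fun k => ?_)
    rw [v_succ_Dt hn k hh' hW, hW_def, add_zero]
    push_cast
    ring
  have hV : V n (Dt h) x = S := hright.tsum_eq
  rw [hV]
  refine ⟨?_, hright⟩
  have h1 : HasSum (fun k => v n k h * W k) (∑' k, v n (k + 1) h * W (k + 1)) :=
    hasSum_of_hasSum_succ (by simp [hW0]) (hs 1)
  have h2 : HasSum (fun k => v n k h * W (k - 1)) (∑' k, v n (k + 2) h * W (k + 1)) :=
    hasSum_of_hasSum_succ (by simp [hW0]) (hasSum_of_hasSum_succ (by simp [hW0]) (hs 2))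
  refine (((hs 0).sub (h1.mul_left 2)).add h2).congr_fun fun k => ?_
  rw [Dt_P hn k hx1]
  cases k with
  | zero =>
    rw [P_of_neg n (by simp : ((0 : ℕ) : ℤ) - 1 < 0)]
    simp [hW_def]
  | succ k =>
    simp only [hW_def, Nat.add_sub_cancel, add_zero]
    rw [show (((k + 1 : ℕ) : ℤ) - 1) = (k : ℤ) by push_cast; ring]
    push_cast
    ring

lemma Vt_eq {n : ℕ} (hn : 1 ≤ n) {h : ℝ → ℝ} (hh : BddContOn h) (hW : MemW2 h)
    {x : ℝ} (hx : 0 ≤ x) : Vt n h x = V n h x - 1 / (n : ℝ) * V n (Dt h) x := by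
  refine HasSum.tsum_eq (((hasSum_V hn hh hx).sub
    ((hasSum_v_mul_Dt_P hn hh hW hx).1.mul_left (1 / (n : ℝ)))).congr_fun fun k => ?_)
  ring

lemma V_succ {n : ℕ} (hn : 1 ≤ n) {h : ℝ → ℝ} (hh : BddContOn h) (hW : MemW2 h)
    {x : ℝ} (hx : 0 ≤ x) :
    V (n + 1) h x = V n h x - 1 / ((n : ℝ) * (n + 1)) * V n (Dt h) x := by
  have hh' := hh
  obtain ⟨-, B, hB⟩ := hh
  have hx1 : -1 < x := by linarith
  have hb (k : ℕ) : |v (n + 1) k h| ≤ B := abs_v_le (n + 1) k hB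
  have hQnn (k : ℕ) : 0 ≤ (k : ℝ) * P n (k : ℤ) x := mul_nonneg (by positivity) (P_nonneg _ _ hx)
  have s1 := (summable_bdd_mul hb (summable_natCast_mul_P hn hx) hQnn).hasSum
  have s2 := (summable_bdd_mul hb
    ((summable_nat_add_iff 1).2 (summable_natCast_mul_P hn hx)) fun k => hQnn (k + 1)).hasSum
  have s0 := (summable_bdd_mul hb (summable_P hn hx) fun k => P_nonneg n (k : ℤ) hx).hasSum
  have s2' : HasSum (fun k : ℕ => v (n + 1) (k - 1) h * ((k : ℝ) * P n (k : ℤ) x)) _ :=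
    hasSum_of_hasSum_succ (by simp) s2
  have hL : HasSum (fun k : ℕ => (n : ℝ) * (v (n + 1) k h * P (n + 1) (k : ℤ) x)) _ :=
    (((s0.mul_left (n : ℝ)).add s1).sub s2).congr_fun fun k => by
      have := mul_P_succ hn (k : ℤ) hx1
      push_cast at this ⊢
      linear_combination v (n + 1) k h * this
  have hR := (((s0.mul_left (n : ℝ)).add s1).sub s2').mul_left ((n : ℝ) + 1)
  have hR' := ((hasSum_V hn hh' hx).mul_left ((n : ℝ) * (n + 1))).sub
    (hasSum_v_mul_Dt_P hn hh' hW hx).2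
  have hterm : (fun k : ℕ => ((n : ℝ) + 1) * (n * (v (n + 1) k h * P n (k : ℤ) x)
        + v (n + 1) k h * ((k : ℝ) * P n (k : ℤ) x)
        - v (n + 1) (k - 1) h * ((k : ℝ) * P n (k : ℤ) x)))
      = fun k : ℕ => (n : ℝ) * (n + 1) * (v n k h * P n (k : ℤ) x)
        - v n k (Dt h) * P n (k : ℤ) x := by
    funext k
    cases k with
    | zero =>
      simp only [v, Dt_apply_zero, if_true]
      push_cast
      ring
    | succ k =>
      have e1 := mul_v_succ n k hh'
      have e2 := mul_v_succ n (k + 1) hh'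
      rw [v_succ_Dt hn k hh' hW]
      simp only [Nat.add_sub_cancel]
      push_cast at e1 e2 ⊢
      linear_combination (P n ((k : ℤ) + 1) x) * (((n : ℝ) + k + 1) * e2 - ((k : ℝ) + 1) * e1)
  rw [hterm] at hR
  have hV := ((hasSum_V (n := n + 1) (by omega) hh' hx).mul_left (n : ℝ)).unique hL
  have hE := hR.unique hR'
  rw [← hV] at hE
  have hn0 : (n : ℝ) ≠ 0 := by positivity
  field_simp
  linear_combination hE

theorem Vt_consecutive_difference (k : ℕ) (hk : 1 ≤ k) (f : ℝ → ℝ) (hf : BddContOn f)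
    (hfW : MemW20 f) (hDfW : MemW20 (Dt f))
    (hDf_cont : ContinuousOn (Dt f) (Set.Ioi 0))
    (hDf_bdd : ∃ M, ∀ x ∈ Set.Ioi (0 : ℝ), |Dt f x| ≤ M) :
    ∀ x ∈ Set.Ici (0 : ℝ),
      Vt k f x - Vt (k + 1) f x
        = -(1 / ((k : ℝ) * ((k : ℝ) + 1) ^ 2)) * V k (Dt (Dt f)) x := by
  intro x hx
  have hx0 : (0 : ℝ) ≤ x := hx
  have hg : BddContOn (Dt f) := by
    constructor
    · intro y hy
      rcases eq_or_lt_of_le (mem_Ici.1 hy) with rfl | hy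
      · rw [← continuousWithinAt_Ioi_iff_Ici, ContinuousWithinAt, Dt_apply_zero]
        exact hfW.2
      · exact (hDf_cont.continuousAt (Ioi_mem_nhds hy)).continuousWithinAt
    · obtain ⟨M, hM⟩ := hDf_bdd
      refine ⟨M, fun y hy => ?_⟩
      rcases eq_or_lt_of_le (mem_Ici.1 hy) with rfl | hy
      · rw [Dt_apply_zero, abs_zero]
        exact (abs_nonneg _).trans (hM 1 (mem_Ioi.2 one_pos))
      · exact hM y hy
  rw [Vt_eq hk hf hfW.1 hx0, Vt_eq (by omega) hf hfW.1 hx0, V_succ hk hf hfW.1 hx0,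
    V_succ hk hg hDfW.1 hx0]
  have hk0 : (k : ℝ) ≠ 0 := by positivity
  push_cast
  field_simp
  ring
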